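/- (Theorem 2.) Let ι be a finite type of users, p : ι → ℝ with 0 < p_i < 1 for all i, and let μ be the product probability measure on Ω = (ι → Bool) assigning to each coordinate i the value true (erasure at user i) with probability p_i, independently across users. Fix the highly critical set P ⊆ ι, and for each candidate target set T ⊆ ι define the 'increase event' A_T = {ω : Ω | ∃ i ∈ P \ T, ω i = false} (some non-targeted critical user receives the packet and hence suffers a decoding delay increment, increasing the maximum anticipated individual completion time). Then μ(A_T) = 1 − ∏_{i ∈ P \ T} p_i, and for any family F of subsets of ι, a set T* ∈ F minimizes μ(A_T) over T ∈ F if and only if T* maximizes ∑_{i ∈ P ∩ T} log(1/p_i) over T ∈ F. -/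

import Mathlib

open MeasureTheory

/-- The erasure measure on `Bool` for a user with erasure probability `p`: the coordinate is
`true` (erased) with probability `p` and `false` (received) with probability `1 - p`. -/
noncomputable def erasureMeasure (p : ℝ) : Measure Bool :=
  ENNReal.ofReal p • Measure.dirac true + ENNReal.ofReal (1 - p) • Measure.dirac false

theorem isProbabilityMeasure_erasureMeasure {p : ℝ} (h0 : 0 ≤ p) (h1 : p ≤ 1) :
    IsProbabilityMeasure (erasureMeasure p) := by
  constructor
  simp only [erasureMeasure, Measure.add_apply, Measure.smul_apply, measure_univ, smul_eq_mul,
    mul_one]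
  rw [← ENNReal.ofReal_add h0 (sub_nonneg.2 h1), add_sub_cancel, ENNReal.ofReal_one]

theorem erasureMeasure_singleton_true (p : ℝ) :
    erasureMeasure p {true} = ENNReal.ofReal p := by
  simp [erasureMeasure]

/-- Some user in `S` receives the packet with probability `1 - ∏ i ∈ S, p i`. -/
theorem pi_erasureMeasure_exists_eq_false {ι : Type*} [Fintype ι] [DecidableEq ι] {p : ι → ℝ}
    (h0 : ∀ i, 0 ≤ p i) (h1 : ∀ i, p i ≤ 1) (S : Finset ι) :
    Measure.pi (fun i => erasureMeasure (p i)) {ω : ι → Bool | ∃ i ∈ S, ω i = false} =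
      1 - ∏ i ∈ S, ENNReal.ofReal (p i) := by
  have := fun i => isProbabilityMeasure_erasureMeasure (h0 i) (h1 i)
  have hset : {ω : ι → Bool | ∃ i ∈ S, ω i = false} =
      (Set.univ.pi fun i => if i ∈ S then {true} else Set.univ)ᶜ := by
    ext ω
    simp only [Set.mem_ofPred_eq, Set.mem_compl_iff, Set.mem_univ_pi, not_forall]
    refine exists_congr fun i => ?_
    by_cases hi : i ∈ S <;> simp [hi]
  rw [hset, prob_compl_eq_one_sub (Set.toFinite _).measurableSet, Measure.pi_pi]
  congr 1
  rw [← Finset.prod_subset S.subset_univ fun i _ hi => by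
    rw [if_neg hi, measure_univ]]
  exact Finset.prod_congr rfl fun i hi => by simp [hi, erasureMeasure_singleton_true]

/-- Maximizing the weight covered by `T` is maximizing the product over the uncovered part. -/
theorem prod_sdiff_le_prod_sdiff_iff {ι : Type*} [DecidableEq ι] {p : ι → ℝ}
    (hp : ∀ i, 0 < p i) (P S T : Finset ι) :
    ∏ i ∈ P \ T, p i ≤ ∏ i ∈ P \ S, p i ↔
      ∑ i ∈ P ∩ T, Real.log (1 / p i) ≤ ∑ i ∈ P ∩ S, Real.log (1 / p i) := by
  rw [← Real.log_le_log_iff (Finset.prod_pos fun i _ => hp i) (Finset.prod_pos fun i _ => hp i),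
    Real.log_prod fun i _ => (hp i).ne', Real.log_prod fun i _ => (hp i).ne']
  simp only [one_div, Real.log_inv, Finset.sum_neg_distrib]
  have hT := Finset.sum_inter_add_sum_sdiff P T fun i => Real.log (p i)
  have hS := Finset.sum_inter_add_sum_sdiff P S fun i => Real.log (p i)
  constructor <;> intro h <;> linarith

/-- Theorem 2: Under the product measure on `Ω = ι → Bool` where coordinate `i`
is `true` (erasure at user `i`) with probability `p i`, independently across users, the
'increase event' `A_T = {ω | ∃ i ∈ P \ T, ω i = false}` (some non-targeted critical user
receives the packet, hence suffers a decoding delay increment) has measure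
`1 - ∏_{i ∈ P \ T} p i`; and over any family `F` of candidate target sets, `T*` minimizes
`μ(A_T)` if and only if it maximizes the weight sum `∑_{i ∈ P ∩ T} log (1 / p i)`. -/
theorem critical_criterion_max_weight_clique
    {ι : Type*} [Fintype ι] [DecidableEq ι]
    (p : ι → ℝ) (hp : ∀ i, 0 < p i ∧ p i < 1) (P : Finset ι) :
    (∀ T : Finset ι,
      Measure.pi (fun i => erasureMeasure (p i))
          {ω : ι → Bool | ∃ i ∈ P \ T, ω i = false} =
        1 - ∏ i ∈ P \ T, ENNReal.ofReal (p i)) ∧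
    (∀ (F : Set (Finset ι)), ∀ Tstar ∈ F,
      ((∀ T ∈ F,
          Measure.pi (fun i => erasureMeasure (p i))
              {ω : ι → Bool | ∃ i ∈ P \ Tstar, ω i = false} ≤
            Measure.pi (fun i => erasureMeasure (p i))
              {ω : ι → Bool | ∃ i ∈ P \ T, ω i = false}) ↔
        (∀ T ∈ F, (∑ i ∈ P ∩ T, Real.log (1 / p i)) ≤
          ∑ i ∈ P ∩ Tstar, Real.log (1 / p i)))) := by
  have hmeas := fun T => pi_erasureMeasure_exists_eq_false
    (fun i => (hp i).1.le) (fun i => (hp i).2.le) (P \ T)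
  refine ⟨hmeas, fun F Tstar _ => forall₂_congr fun T _ => ?_⟩
  have hle : ∏ i ∈ P \ T, p i ≤ 1 :=
    Finset.prod_le_one (fun i _ => (hp i).1.le) fun i _ => (hp i).2.le
  have hnonneg (U : Finset ι) : 0 ≤ ∏ i ∈ U, p i := Finset.prod_nonneg fun i _ => (hp i).1.le
  rw [hmeas, hmeas, ← prod_sdiff_le_prod_sdiff_iff fun i => (hp i).1,
    ← ENNReal.ofReal_prod_of_nonneg fun i _ => (hp i).1.le,
    ← ENNReal.ofReal_prod_of_nonneg fun i _ => (hp i).1.le, ← ENNReal.ofReal_one,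
    ← ENNReal.ofReal_sub _ (hnonneg _), ← ENNReal.ofReal_sub _ (hnonneg _),
    ENNReal.ofReal_le_ofReal_iff (sub_nonneg.2 hle), sub_le_sub_iff_left]
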